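/- Let I be a monomial ideal generated in degree d. Then I is linearly related if and only if for all u, v in G(I) there is a path in the graph G_I^{(u,v)} connecting u and v. -/

import Mathlib

open MvPolynomial

noncomputable section

abbrev SRing (K : Type) [Field K] (n : ℕ) := MvPolynomial (Fin n) K

/-- total degree of an exponent vector -/
def mdeg {n : ℕ} (e : Fin n →₀ ℕ) : ℕ := e.sum fun _ v => v

/-- minimal monomial generators of a monomial ideal, as exponent vectors:
monomials in `J` none of whose proper divisors lies in `J` -/
def minGen {K : Type} [Field K] {n : ℕ} (J : Ideal (SRing K n)) : Set (Fin n →₀ ℕ) :=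
  {e | (monomial e (1:K)) ∈ J ∧
    ∀ e' : Fin n →₀ ℕ, e' ≤ e → e' ≠ e → (monomial e' (1:K)) ∉ J}

/-- adjacency in the graph `G_J^{(u,v)}` : vertices are the minimal generators of `J`
dividing `lcm(u,v)`, with an edge between two of them iff their lcm has degree `d+1` -/
def lcmGraphAdj {K : Type} [Field K] {n : ℕ} (J : Ideal (SRing K n)) (d : ℕ)
    (u v : Fin n →₀ ℕ) (w w' : Fin n →₀ ℕ) : Prop :=
  w ∈ minGen J ∧ w' ∈ minGen J ∧ w ≤ u ⊔ v ∧ w' ≤ u ⊔ v ∧ mdeg (w ⊔ w') = d + 1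

/-- a graded partial free resolution of the ideal `I`, exact at homological positions `< r`:
`F_i` is free with basis in (internal) degrees `dg i`, the maps are graded of degree `0`,
`F_0` surjects onto `I`, and the sequence is exact at `F_i` for `i < r`. -/
structure GradedPartialRes {K : Type} [Field K] {n : ℕ} (I : Ideal (SRing K n)) (r : ℕ∞) where
  s : ℕ → ℕ
  dg : ∀ i, Fin (s i) → ℕ
  aug : (Fin (s 0) →₀ SRing K n) →ₗ[SRing K n] SRing K n
  diff : ∀ i, (Fin (s (i+1)) →₀ SRing K n) →ₗ[SRing K n] (Fin (s i) →₀ SRing K n)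
  aug_hom : ∀ k, (aug (Finsupp.single k 1)).IsHomogeneous (dg 0 k)
  diff_hom : ∀ i k l, (diff i (Finsupp.single k 1)) l = 0 ∨
      ∃ m, ((diff i (Finsupp.single k 1)) l).IsHomogeneous m ∧ dg i l + m = dg (i+1) k
  aug_range : LinearMap.range aug = I
  exact_zero : (0 : ℕ∞) < r → LinearMap.range (diff 0) = LinearMap.ker aug
  exact_succ : ∀ i : ℕ, ((i : ℕ∞) + 1) < r →
      LinearMap.range (diff (i+1)) = LinearMap.ker (diff i)

/-- the graded Betti number `β_{i,j}(I)`: the minimal number of degree-`j` basis elements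
in homological position `i`, over all graded partial resolutions of `I` exact at
positions `0, …, i` (the minimum is attained by the minimal graded free resolution). -/
def gradedBetti {K : Type} [Field K] {n : ℕ} (I : Ideal (SRing K n)) (i j : ℕ) : ℕ∞ :=
  ⨅ R : GradedPartialRes I ((i : ℕ∞)+1),
    ((Finset.univ.filter fun k => R.dg i k = j).card : ℕ∞)

/-- `I` (generated in degree `d`) is `r` steps linear: `β_{i,i+j}(I) = 0` for
all `i ≤ r` and `j > d` -/
def stepsLinear {K : Type} [Field K] {n : ℕ} (I : Ideal (SRing K n)) (d r : ℕ) : Prop :=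
  ∀ i ≤ r, ∀ j, d < j → gradedBetti I i (i+j) = 0

/-- `index(I) = sup{r : I is r steps linear} + 1` -/
def idealIndex {K : Type} [Field K] {n : ℕ} (I : Ideal (SRing K n)) (d : ℕ) : ℕ∞ :=
  sSup {x : ℕ∞ | ∃ r : ℕ, x = (r : ℕ∞) + 1 ∧ stepsLinear I d r}

/-- `I` is linearly related: all first syzygies are linear, i.e. `index(I) > 1` -/
def LinearlyRelated {K : Type} [Field K] {n : ℕ} (I : Ideal (SRing K n)) (d : ℕ) : Prop :=
  stepsLinear I d 1

/-- projective dimension of `I`: the minimal length of a graded free resolution of `I` -/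
def projDim {K : Type} [Field K] {n : ℕ} (I : Ideal (SRing K n)) : ℕ∞ :=
  sInf {x : ℕ∞ | ∃ m : ℕ, x = (m : ℕ∞) ∧
    ∃ R : GradedPartialRes I ⊤, ∀ i : ℕ, m < i → R.s i = 0}

/-- the edge ideal of the graph (possibly with loops) given by a symmetric relation `E`:
generated by the monomials `X i * X j` with `E i j` -/
def edgeIdeal (K : Type) [Field K] {n : ℕ} (E : Fin n → Fin n → Prop) : Ideal (SRing K n) :=
  Ideal.span {p | ∃ i j, E i j ∧ p = X i * X j}

/-- `E` is gap free: for any two disjoint edges there is an edge meeting both -/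
def GapFree {n : ℕ} (E : Fin n → Fin n → Prop) : Prop :=
  ∀ i i' j j', E i i' → E j j' → i ≠ j → i ≠ j' → i' ≠ j → i' ≠ j' →
    ∃ a b, E a b ∧ (a = i ∨ a = i') ∧ (b = j ∨ b = j')

theorem mdeg_eq_degree {n : ℕ} (e : Fin n →₀ ℕ) : mdeg e = e.degree := rfl

section GradedFree

variable {K : Type} [Field K] {n s t : ℕ}

/-- The degree `m` part of the graded free module with basis in degrees `dg`. -/
def gradedPart (K : Type) [Field K] (n : ℕ) {s : ℕ} (dg : Fin s → ℕ) (m : ℕ) :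
    Submodule K (Fin s →₀ SRing K n) where
  carrier := {f | ∀ i a, coeff a (f i) ≠ 0 → a.degree + dg i = m}
  zero_mem' := by
    intro i a h
    simp at h
  add_mem' := by
    intro f g hf hg i a h
    by_cases h' : coeff a (f i) = 0
    · exact hg i a fun h'' => h (by simp [h', h''])
    · exact hf i a h'
  smul_mem' := by
    intro c f hf i a h
    refine hf i a fun h' => h ?_
    simp [h']

theorem smul_mem_gradedPart {dg : Fin s → ℕ} {m k : ℕ} {f : Fin s →₀ SRing K n}
    (hf : f ∈ gradedPart K n dg m) {q : SRing K n} (hq : q.IsHomogeneous k) :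
    q • f ∈ gradedPart K n dg (k + m) := by
  classical
  intro i a h
  rw [Finsupp.smul_apply, smul_eq_mul, coeff_mul] at h
  obtain ⟨⟨b, c⟩, hbc, hne⟩ := Finset.exists_ne_zero_of_sum_ne_zero h
  rw [Finset.HasAntidiagonal.mem_antidiagonal] at hbc
  have hb : b.degree = k := by
    by_contra hb
    exact hne (by simp [hq.coeff_eq_zero hb])
  have hc := hf i c fun hc => hne (by simp [hc])
  have : a.degree = b.degree + c.degree := by
    rw [← hbc, map_add]
  omega

theorem single_mem_gradedPart {dg : Fin s → ℕ} {k : ℕ} (i : Fin s) {q : SRing K n}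
    (hq : q.IsHomogeneous k) : Finsupp.single i q ∈ gradedPart K n dg (k + dg i) := by
  intro j a h
  by_cases hij : i = j
  · subst hij
    rw [Finsupp.single_eq_same] at h
    have : a.degree = k := by
      by_contra ha
      exact h (hq.coeff_eq_zero ha)
    omega
  · rw [Finsupp.single_eq_of_ne (Ne.symm hij)] at h
    simp at h

theorem mem_gradedPart_iff_isHomogeneous {dg : Fin s → ℕ} {m : ℕ} {f : Fin s →₀ SRing K n} :
    f ∈ gradedPart K n dg m ↔
      ∀ l, f l = 0 ∨ ∃ k, (f l).IsHomogeneous k ∧ dg l + k = m := by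
  constructor
  · intro hf l
    by_cases h0 : f l = 0
    · exact Or.inl h0
    · obtain ⟨a, ha⟩ := exists_coeff_ne_zero h0
      refine Or.inr ⟨a.degree, ?_, by have := hf l a ha; omega⟩
      intro b hb
      have h1 := hf l a ha
      have h2 := hf l b hb
      have hw : Finsupp.weight 1 b = b.degree := by
        rw [Finsupp.degree_eq_weight_one]
        rfl
      rw [hw]
      omega
  · intro h i a ha
    rcases h i with h0 | ⟨k, hk, hkm⟩
    · simp [h0] at ha
    · have : a.degree = k := by
        by_contra h'
        exact ha (hk.coeff_eq_zero h')
      omega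

/-- The projection onto the degree `m` part. -/
def gradedComponent (dg : Fin s → ℕ) (m : ℕ) (f : Fin s →₀ SRing K n) : Fin s →₀ SRing K n :=
  Finsupp.equivFunOnFinite.symm fun i =>
    if dg i ≤ m then homogeneousComponent (m - dg i) (f i) else 0

theorem coeff_gradedComponent (dg : Fin s → ℕ) (m : ℕ) (f : Fin s →₀ SRing K n) (i : Fin s)
    (a : Fin n →₀ ℕ) :
    coeff a (gradedComponent dg m f i) = if a.degree + dg i = m then coeff a (f i) else 0 := by
  simp only [gradedComponent, Finsupp.equivFunOnFinite_symm_apply_apply]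
  by_cases h : dg i ≤ m
  · rw [if_pos h, coeff_homogeneousComponent]
    congr 1
    exact propext (by omega)
  · rw [if_neg h, if_neg (by omega), coeff_zero]

theorem gradedComponent_mem (dg : Fin s → ℕ) (m : ℕ) (f : Fin s →₀ SRing K n) :
    gradedComponent dg m f ∈ gradedPart K n dg m := by
  intro i a h
  rw [coeff_gradedComponent] at h
  by_contra h'
  exact h (if_neg h')

theorem gradedComponent_add (dg : Fin s → ℕ) (m : ℕ) (f g : Fin s →₀ SRing K n) :
    gradedComponent dg m (f + g) = gradedComponent dg m f + gradedComponent dg m g := by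
  ext i a
  simp only [coeff_gradedComponent, Finsupp.add_apply, coeff_add]
  split_ifs <;> simp

theorem gradedComponent_zero (dg : Fin s → ℕ) (m : ℕ) :
    gradedComponent dg m (0 : Fin s →₀ SRing K n) = 0 := by
  ext i a
  simp [coeff_gradedComponent]

theorem gradedComponent_of_mem {dg : Fin s → ℕ} {k : ℕ} {f : Fin s →₀ SRing K n}
    (hf : f ∈ gradedPart K n dg k) (m : ℕ) :
    gradedComponent dg m f = if k = m then f else 0 := by
  ext i a
  rw [coeff_gradedComponent]
  by_cases h0 : coeff a (f i) = 0
  · split_ifs <;> simp [h0]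
  · have := hf i a h0
    rw [this]
    split_ifs <;> simp

theorem exists_sum_gradedComponent (dg : Fin s → ℕ) (f : Fin s →₀ SRing K n) :
    ∃ N, ∑ m ∈ Finset.range N, gradedComponent dg m f = f := by
  refine ⟨(Finset.univ.sup fun i => (f i).totalDegree + dg i) + 1, ?_⟩
  ext i a
  rw [Finsupp.finsetSum_apply, coeff_sum]
  simp only [coeff_gradedComponent]
  rw [Finset.sum_ite_eq]
  split_ifs with h
  · rfl
  · symm
    refine coeff_eq_zero_of_totalDegree_lt ?_
    have hle : (f i).totalDegree + dg i ≤ Finset.univ.sup fun i => (f i).totalDegree + dg i :=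
      Finset.le_sup (f := fun i => (f i).totalDegree + dg i) (Finset.mem_univ i)
    rw [Finset.mem_range] at h
    change _ < a.degree
    omega

/-- Every element of a free module is a sum of monomial multiples of basis vectors. -/
theorem free_induction {p : (Fin s →₀ SRing K n) → Prop} (f : Fin s →₀ SRing K n) (h0 : p 0)
    (hadd : ∀ f g, p f → p g → p (f + g))
    (hmon : ∀ i a (c : K), p (Finsupp.single i (monomial a c))) : p f := by
  induction f using Finsupp.induction_linear with
  | zero => exact h0
  | add f g hf hg => exact hadd f g hf hg
  | single i q =>
    induction q using MvPolynomial.induction_on' with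
    | monomial a c => exact hmon i a c
    | add q r hq hr =>
      rw [Finsupp.single_add]
      exact hadd _ _ hq hr

theorem map_gradedComponent {dg : Fin s → ℕ} {dg' : Fin t → ℕ}
    (D : (Fin t →₀ SRing K n) →ₗ[SRing K n] (Fin s →₀ SRing K n))
    (hD : ∀ k, D (Finsupp.single k 1) ∈ gradedPart K n dg (dg' k)) (m : ℕ)
    (f : Fin t →₀ SRing K n) :
    D (gradedComponent dg' m f) = gradedComponent dg m (D f) := by
  induction f using free_induction with
  | h0 => simp [gradedComponent_zero]
  | hadd f g hf hg => simp only [gradedComponent_add, map_add, hf, hg]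
  | hmon k a c =>
    have hq : (monomial a c : SRing K n).IsHomogeneous a.degree := isHomogeneous_monomial c rfl
    have h1 := single_mem_gradedPart (dg := dg') k hq
    have h2 : D (Finsupp.single k (monomial a c)) ∈ gradedPart K n dg (a.degree + dg' k) := by
      have : Finsupp.single k (monomial a c : SRing K n)
          = (monomial a c : SRing K n) • Finsupp.single k 1 := by
        simp
      rw [this, map_smul]
      exact smul_mem_gradedPart (hD k) hq
    rw [gradedComponent_of_mem h1, gradedComponent_of_mem h2]
    split_ifs <;> simp

theorem span_homogeneous_ker {dg : Fin s → ℕ} {dg' : Fin t → ℕ}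
    (D : (Fin t →₀ SRing K n) →ₗ[SRing K n] (Fin s →₀ SRing K n))
    (hD : ∀ k, D (Finsupp.single k 1) ∈ gradedPart K n dg (dg' k)) :
    Submodule.span (SRing K n) {f | D f = 0 ∧ ∃ m, f ∈ gradedPart K n dg' m}
      = LinearMap.ker D := by
  refine le_antisymm (Submodule.span_le.2 fun f hf => hf.1) fun f hf => ?_
  obtain ⟨N, hN⟩ := exists_sum_gradedComponent dg' f
  rw [← hN]
  refine Submodule.sum_mem _ fun m _ => Submodule.subset_span ⟨?_, m, gradedComponent_mem _ _ _⟩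
  rw [map_gradedComponent D hD, LinearMap.mem_ker.1 hf, gradedComponent_zero]

/-- A submodule spanned by homogeneous elements is the image of a graded map from a finite
free module. -/
theorem exists_graded_cover (dg : Fin s → ℕ) (P : ℕ → Prop) (H : Set (Fin s →₀ SRing K n))
    (hH : ∀ f ∈ H, ∃ m, P m ∧ f ∈ gradedPart K n dg m) :
    ∃ (t : ℕ) (dg' : Fin t → ℕ) (D : (Fin t →₀ SRing K n) →ₗ[SRing K n] (Fin s →₀ SRing K n)),
      LinearMap.range D = Submodule.span (SRing K n) H ∧
      (∀ k, D (Finsupp.single k 1) ∈ gradedPart K n dg (dg' k)) ∧ ∀ k, P (dg' k) := by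
  have hfg : (Submodule.span (SRing K n) H).FG := IsNoetherian.noetherian _
  obtain ⟨F, hF, hspan⟩ := Submodule.fg_span_iff_fg_span_finset_subset H |>.1 hfg
  obtain ⟨t, f, -, hf⟩ := F.finite_toSet.fin_param
  have hfH : ∀ k, f k ∈ H := fun k => hF (hf ▸ Set.mem_range_self k)
  choose dg' hP hdg' using fun k => hH (f k) (hfH k)
  refine ⟨t, dg', Finsupp.linearCombination (SRing K n) f, ?_, fun k => ?_, hP⟩
  · rw [Finsupp.range_linearCombination, hf, ← hspan]
  · simpa using hdg' k

end GradedFree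

section MonomialSyzygies

variable {K : Type} [Field K] {n s d : ℕ} (w : Fin s → Fin n →₀ ℕ)

/-- The map from the free module sending the basis vectors to the monomials with exponents `w`. -/
def monomialMap (K : Type) [Field K] {n s : ℕ} (w : Fin s → Fin n →₀ ℕ) :
    (Fin s →₀ SRing K n) →ₗ[SRing K n] SRing K n :=
  Finsupp.linearCombination (SRing K n) fun i => monomial (w i) (1 : K)

theorem monomialMap_single (i : Fin s) (q : SRing K n) :
    monomialMap K w (Finsupp.single i q) = q * monomial (w i) 1 := by
  simp [monomialMap]

theorem monomialMap_apply (f : Fin s →₀ SRing K n) :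
    monomialMap K w f = ∑ i, f i * monomial (w i) 1 := by
  simp only [monomialMap, Finsupp.linearCombination_apply, smul_eq_mul]
  exact Finsupp.sum_fintype _ _ (by simp)

theorem coeff_monomialMap (L : Fin n →₀ ℕ) (f : Fin s →₀ SRing K n) :
    coeff L (monomialMap K w f) = ∑ i, if w i ≤ L then coeff (L - w i) (f i) else 0 := by
  rw [monomialMap_apply, coeff_sum]
  simp only [coeff_mul_monomial', mul_one]

theorem range_monomialMap :
    LinearMap.range (monomialMap K w)
      = Ideal.span ((fun e => (monomial e (1 : K) : SRing K n)) '' Set.range w) := by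
  rw [monomialMap, Finsupp.range_linearCombination, ← Set.range_comp]
  rfl

open Classical in
/-- A `K`-linear section of `monomialMap` over the monomial ideal generated by `w`, vanishing on
the monomials outside that ideal. -/
def monomialSection (K : Type) [Field K] {n s : ℕ} (w : Fin s → Fin n →₀ ℕ) :
    SRing K n →ₗ[K] (Fin s →₀ SRing K n) :=
  (basisMonomials (Fin n) K).constr K fun e =>
    if h : ∃ i, w i ≤ e then Finsupp.single h.choose (monomial (e - w h.choose) 1) else 0

open Classical in
theorem monomialSection_monomial_one (e : Fin n →₀ ℕ) :
    monomialSection K w (monomial e 1) =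
      if h : ∃ i, w i ≤ e then Finsupp.single h.choose (monomial (e - w h.choose) 1) else 0 := by
  have := (basisMonomials (Fin n) K).constr_basis K (fun e =>
    if h : ∃ i, w i ≤ e then
      (Finsupp.single h.choose (monomial (e - w h.choose) 1) : Fin s →₀ SRing K n) else 0) e
  rwa [coe_basisMonomials] at this

theorem exists_monomialSection_eq {e : Fin n →₀ ℕ} (h : ∃ i, w i ≤ e) :
    ∃ i, w i ≤ e ∧
      monomialSection K w (monomial e 1) = Finsupp.single i (monomial (e - w i) 1) :=
  ⟨h.choose, h.choose_spec, by rw [monomialSection_monomial_one, dif_pos h]⟩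

theorem monomialMap_monomialSection_monomialMap (f : Fin s →₀ SRing K n) :
    monomialMap K w (monomialSection K w (monomialMap K w f)) = monomialMap K w f := by
  induction f using free_induction with
  | h0 => simp
  | hadd f g hf hg => simp only [map_add, hf, hg]
  | hmon i a c =>
    have h1 : monomialMap K w (Finsupp.single i (monomial a c))
        = c • (monomial (a + w i) 1 : SRing K n) := by
      rw [monomialMap_single, monomial_mul, smul_monomial, smul_eq_mul]
    obtain ⟨j, hj, hsec⟩ := exists_monomialSection_eq (K := K) w (e := a + w i)
      ⟨i, le_add_self⟩
    rw [h1, map_smul, hsec, Finsupp.smul_single, monomialMap_single, smul_mul_assoc,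
      monomial_mul, tsub_add_cancel_of_le hj, mul_one]

theorem monomialMap_monomialSection {p : SRing K n} (hp : p ∈ LinearMap.range (monomialMap K w)) :
    monomialMap K w (monomialSection K w p) = p := by
  obtain ⟨f, rfl⟩ := hp
  exact monomialMap_monomialSection_monomialMap w f

theorem monomialSection_mem_gradedPart (hw : ∀ i, (w i).degree = d) {p : SRing K n} {m : ℕ}
    (hp : p.IsHomogeneous m) : monomialSection K w p ∈ gradedPart K n (fun _ => d) m := by
  have hsum : p = ∑ e ∈ p.support, coeff e p • (monomial e 1 : SRing K n) := by
    conv_lhs => rw [p.as_sum]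
    simp [smul_monomial]
  rw [hsum, map_sum]
  refine Submodule.sum_mem _ fun e he => ?_
  rw [map_smul]
  refine Submodule.smul_mem _ _ ?_
  have hem : e.degree = m := by
    by_contra h
    exact mem_support_iff.1 he (hp.coeff_eq_zero h)
  by_cases h : ∃ i, w i ≤ e
  · obtain ⟨i, hi, hsec⟩ := exists_monomialSection_eq (K := K) w h
    rw [hsec]
    have hdeg : (e - w i).degree + d = m := by
      rw [← hw i, ← map_add, tsub_add_cancel_of_le hi, hem]
    have := single_mem_gradedPart (K := K) (dg := fun _ => d) i
      (isHomogeneous_monomial (1 : K) (rfl : (e - w i).degree = _))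
    simpa only [hdeg] using this
  · rw [monomialSection_monomial_one, dif_neg h]
    exact Submodule.zero_mem _

open Classical in
/-- The sum of the coefficients in multidegree `L` of the components indexed by `C`. -/
def multidegreeSum (K : Type) [Field K] {n s : ℕ} (w : Fin s → Fin n →₀ ℕ) (L : Fin n →₀ ℕ)
    (C : Set (Fin s)) : (Fin s →₀ SRing K n) →ₗ[K] K :=
  ∑ i, if i ∈ C ∧ w i ≤ L then lcoeff K (L - w i) ∘ₗ Finsupp.lapply i else 0

open Classical in
theorem multidegreeSum_apply (L : Fin n →₀ ℕ) (C : Set (Fin s)) (f : Fin s →₀ SRing K n) :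
    multidegreeSum K w L C f = ∑ i, if i ∈ C ∧ w i ≤ L then coeff (L - w i) (f i) else 0 := by
  simp only [multidegreeSum, LinearMap.sum_apply]
  refine Finset.sum_congr rfl fun i _ => ?_
  split_ifs <;> rfl

theorem multidegreeSum_monomial_smul (L : Fin n →₀ ℕ) (C : Set (Fin s)) (a : Fin n →₀ ℕ) (c : K)
    (f : Fin s →₀ SRing K n) :
    multidegreeSum K w L C ((monomial a c : SRing K n) • f)
      = if a ≤ L then c * multidegreeSum K w (L - a) C f else 0 := by
  classical
  simp only [multidegreeSum_apply, Finsupp.smul_apply, smul_eq_mul, coeff_monomial_mul',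
    Finset.mul_sum]
  by_cases ha : a ≤ L
  · rw [if_pos ha]
    refine Finset.sum_congr rfl fun i _ => ?_
    by_cases hi : i ∈ C
    · by_cases h : w i + a ≤ L
      · have h1 : w i ≤ L := le_trans le_self_add h
        have h2 : a ≤ L - w i := le_tsub_of_add_le_left h
        have h3 : w i ≤ L - a := le_tsub_of_add_le_right h
        rw [if_pos ⟨hi, h1⟩, if_pos h2, if_pos ⟨hi, h3⟩, tsub_right_comm]
      · have h3 : ¬ w i ≤ L - a := fun h3 => h ((le_tsub_iff_right ha).1 h3)
        rw [if_neg (c := i ∈ C ∧ w i ≤ L - a) (fun h' => h3 h'.2), mul_zero]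
        split_ifs with h1 h2
        · exact absurd ((le_tsub_iff_left h1.2).1 h2) h
        · rfl
        · rfl
    · simp [hi]
  · rw [if_neg ha]
    refine Finset.sum_eq_zero fun i _ => ?_
    split_ifs with h1 h2
    · exact absurd (h2.trans tsub_le_self) ha
    · rfl
    · rfl

theorem multidegreeSum_eq_zero_of_mem_gradedPart (hw : ∀ i, (w i).degree = d) {L : Fin n →₀ ℕ}
    (C : Set (Fin s)) {m : ℕ} (hm : m ≠ L.degree) {f : Fin s →₀ SRing K n}
    (hf : f ∈ gradedPart K n (fun _ => d) m) : multidegreeSum K w L C f = 0 := by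
  classical
  rw [multidegreeSum_apply]
  refine Finset.sum_eq_zero fun i _ => ?_
  split_ifs with h
  · by_contra h'
    refine hm ?_
    rw [← hf i _ h']
    change (L - w i).degree + d = _
    rw [← hw i, ← map_add, tsub_add_cancel_of_le h.2]
  · rfl

/-- If the functional vanishes on the multiples of `f` by nonconstant monomials, then its value on
`q • f` only depends on the constant coefficient of `q`. -/
theorem multidegreeSum_smul {L : Fin n →₀ ℕ} {C : Set (Fin s)} {f : Fin s →₀ SRing K n}
    (hf : ∀ a ≠ 0, a ≤ L → multidegreeSum K w (L - a) C f = 0) (q : SRing K n) :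
    multidegreeSum K w L C (q • f) = coeff 0 q * multidegreeSum K w L C f := by
  induction q using MvPolynomial.induction_on' with
  | monomial a c =>
    rw [multidegreeSum_monomial_smul]
    by_cases ha : a = 0
    · subst ha
      simp
    · rw [coeff_monomial, if_neg ha, zero_mul]
      split_ifs with h
      · rw [hf a ha h, mul_zero]
      · rfl
  | add p q hp hq => rw [add_smul, map_add, hp, hq, coeff_add, add_mul]

theorem degree_tsub_lt {L a : Fin n →₀ ℕ} (ha : a ≠ 0) (hL : a ≤ L) :
    (L - a).degree < L.degree := by
  have h1 : (L - a).degree + a.degree = L.degree := by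
    rw [← map_add, tsub_add_cancel_of_le hL]
  have h2 : a.degree ≠ 0 := fun h => ha ((Finsupp.degree_eq_zero_iff a).1 h)
  omega

theorem eq_of_le_of_degree_le {a b : Fin n →₀ ℕ} (h : a ≤ b) (hd : b.degree ≤ a.degree) :
    a = b := by
  have h1 : (b - a).degree + a.degree = b.degree := by
    rw [← map_add, tsub_add_cancel_of_le h]
  have h2 : b - a = 0 := (Finsupp.degree_eq_zero_iff _).1 (by omega)
  exact le_antisymm h (tsub_eq_zero_iff_le.1 h2)

theorem constantCoeff_eq_zero_of_syzygy (hinj : Function.Injective w)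
    (hw : ∀ i, (w i).degree = d) {z : Fin s →₀ SRing K n} (hz : monomialMap K w z = 0)
    (i : Fin s) : coeff 0 (z i) = 0 := by
  have h := coeff_monomialMap w (w i) z
  rw [hz, coeff_zero, Finset.sum_eq_single i] at h
  · simpa using h.symm
  · intro j _ hji
    rw [if_neg]
    intro hle
    exact hji (hinj (eq_of_le_of_degree_le hle (by rw [hw, hw])))
  · simp

/-- `C` is a union of connected components of the graph on the generators dividing `L`, with edges
the pairs whose lcm has degree `d + 1`. -/
def ClosedBelow (d : ℕ) (w : Fin s → Fin n →₀ ℕ) (L : Fin n →₀ ℕ) (C : Set (Fin s)) : Prop :=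
  ∀ i ∈ C, ∀ j, w i ≤ L → w j ≤ L → (w i ⊔ w j).degree = d + 1 → j ∈ C

theorem ClosedBelow.mono {w : Fin s → Fin n →₀ ℕ} {L L' : Fin n →₀ ℕ} {C : Set (Fin s)}
    (h : ClosedBelow d w L C) (hL : L' ≤ L) : ClosedBelow d w L' C :=
  fun i hi j hiL hjL => h i hi j (hiL.trans hL) (hjL.trans hL)

theorem multidegreeSum_eq_zero_of_degree_le (hinj : Function.Injective w)
    (hw : ∀ i, (w i).degree = d) {L : Fin n →₀ ℕ} (hL : L.degree ≤ d + 1) {C : Set (Fin s)}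
    (hC : ClosedBelow d w L C) {z : Fin s →₀ SRing K n} (hz : monomialMap K w z = 0) :
    multidegreeSum K w L C z = 0 := by
  classical
  rw [multidegreeSum_apply]
  by_cases hne : ∃ i ∈ C, w i ≤ L
  · obtain ⟨i, hi, hiL⟩ := hne
    have hall : ∀ j, w j ≤ L → j ∈ C := by
      intro j hjL
      by_cases hdeg : (w i ⊔ w j).degree = d + 1
      · exact hC i hi j hiL hjL hdeg
      · have h1 : (w i ⊔ w j).degree ≤ L.degree := Finsupp.degree_mono (sup_le hiL hjL)
        have h2 : (w i ⊔ w j).degree ≤ d := by omega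
        have h3 : w i = w i ⊔ w j := eq_of_le_of_degree_le le_sup_left (by rw [hw]; exact h2)
        have h4 : w j = w i ⊔ w j := eq_of_le_of_degree_le le_sup_right (by rw [hw]; exact h2)
        exact hinj (h4.trans h3.symm) ▸ hi
    have h := coeff_monomialMap w L z
    rw [hz, coeff_zero] at h
    refine (Finset.sum_congr rfl fun j _ => ?_).trans h.symm
    congr 1
    exact propext ⟨fun h => h.2, fun h => ⟨hall j h, h⟩⟩
  · refine Finset.sum_eq_zero fun i _ => if_neg fun h => hne ⟨i, h⟩

end MonomialSyzygies

section LinearSyzygies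

variable {K : Type} [Field K] {n s d : ℕ}

/-- Forget exactness in high homological positions. -/
def GradedPartialRes.weaken {I : Ideal (SRing K n)} {r r' : ℕ∞} (R : GradedPartialRes I r)
    (h : r' ≤ r) : GradedPartialRes I r' where
  s := R.s
  dg := R.dg
  aug := R.aug
  diff := R.diff
  aug_hom := R.aug_hom
  diff_hom := R.diff_hom
  aug_range := R.aug_range
  exact_zero h' := R.exact_zero (h'.trans_le h)
  exact_succ i h' := R.exact_succ i (h'.trans_le h)

theorem gradedBetti_eq_zero_iff {I : Ideal (SRing K n)} {i j : ℕ} :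
    gradedBetti I i j = 0 ↔ ∃ R : GradedPartialRes I ((i : ℕ∞) + 1), ∀ k, R.dg i k ≠ j := by
  simp only [gradedBetti, ENat.iInf_eq_zero]
  refine exists_congr fun R => ?_
  rw [Nat.cast_eq_zero, Finset.card_eq_zero, Finset.filter_eq_empty_iff]
  simp

theorem finite_minGen {I : Ideal (SRing K n)} (hdeg : ∀ e ∈ minGen I, mdeg e = d) :
    (minGen I).Finite := by
  refine (Set.finite_Iic (Finsupp.equivFunOnFinite.symm fun _ : Fin n => d)).subset ?_
  intro e he i
  rw [Finsupp.equivFunOnFinite_symm_apply_apply, ← hdeg e he, mdeg_eq_degree]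
  exact Finsupp.le_degree i e

/-- The functionals on components vanish on all syzygies in a given multidegree, if they do so in
all smaller ones and some resolution has no first syzygies in that degree. -/
theorem multidegreeSum_eq_zero_of_resolution {w : Fin s → Fin n →₀ ℕ}
    (hinj : Function.Injective w) (hw : ∀ i, (w i).degree = d) {I : Ideal (SRing K n)}
    (hI : LinearMap.range (monomialMap K w) = I) {L : Fin n →₀ ℕ} {C : Set (Fin s)}
    (R : GradedPartialRes I 2) (hR : ∀ k, R.dg 1 k ≠ L.degree)
    (ih : ∀ a ≠ 0, a ≤ L → ∀ z, monomialMap K w z = 0 → multidegreeSum K w (L - a) C z = 0)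
    {z : Fin s →₀ SRing K n} (hz : monomialMap K w z = 0) : multidegreeSum K w L C z = 0 := by
  have hex : LinearMap.range (R.diff 0) = LinearMap.ker R.aug := R.exact_zero (by norm_num)
  let Ψ : (Fin (R.s 0) →₀ SRing K n) →ₗ[SRing K n] (Fin s →₀ SRing K n) :=
    Finsupp.linearCombination (SRing K n)
      fun l => monomialSection K w (R.aug (Finsupp.single l 1))
  have hΨ : ∀ y, monomialMap K w (Ψ y) = R.aug y := by
    intro y
    have : monomialMap K w ∘ₗ Ψ = R.aug := by
      refine Finsupp.lhom_ext' fun l => LinearMap.ext_ring ?_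
      simp only [LinearMap.comp_apply, Finsupp.lsingle_apply, Ψ,
        Finsupp.linearCombination_single, one_smul]
      refine monomialMap_monomialSection w ?_
      rw [hI]
      exact R.aug_range.le (LinearMap.mem_range_self R.aug _)
    exact LinearMap.congr_fun this y
  have hmem : ∀ k, Ψ (R.diff 0 (Finsupp.single k 1)) ∈ gradedPart K n (fun _ => d) (R.dg 1 k) := by
    intro k
    simp only [Ψ, Finsupp.linearCombination_apply]
    refine Submodule.sum_mem _ fun l _ => ?_
    change (R.diff 0 (Finsupp.single k 1)) l • _ ∈ _
    rcases R.diff_hom 0 k l with h0 | ⟨m, hm, hdm⟩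
    · rw [h0, zero_smul]
      exact Submodule.zero_mem _
    · have := smul_mem_gradedPart (monomialSection_mem_gradedPart w hw (R.aug_hom l)) hm
      rwa [add_comm m, hdm] at this
  have hker : ∀ y, R.aug y = 0 → multidegreeSum K w L C (Ψ y) = 0 := by
    intro y hy
    have hy' : y ∈ LinearMap.range (R.diff 0) := hex ▸ hy
    obtain ⟨x, rfl⟩ := hy'
    have hd : ∀ x, monomialMap K w (Ψ (R.diff 0 x)) = 0 := by
      intro x
      rw [hΨ]
      have : R.diff 0 x ∈ LinearMap.ker R.aug := hex ▸ LinearMap.mem_range_self _ x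
      exact this
    clear hy
    induction x using Finsupp.induction_linear with
    | zero => simp
    | add f g hf hg => simp only [map_add, hf, hg, add_zero]
    | single k q =>
      have : (Finsupp.single k q : Fin (R.s 1) →₀ SRing K n) = q • Finsupp.single k 1 := by simp
      rw [this, map_smul, map_smul, multidegreeSum_smul w fun a ha haL => ih a ha haL _ (hd _),
        multidegreeSum_eq_zero_of_mem_gradedPart w hw C (hR k) (hmem k), mul_zero]
  have hlift : ∀ i, ∃ y, R.aug y = monomial (w i) 1 := by
    intro i
    have : (monomial (w i) 1 : SRing K n) ∈ LinearMap.range R.aug := by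
      rw [R.aug_range, ← hI]
      exact ⟨Finsupp.single i 1, by rw [monomialMap_single, one_mul]⟩
    exact this
  choose y hy using hlift
  have hsplit : z = ∑ i, z i • (Finsupp.single i 1 - Ψ (y i)) + Ψ (∑ i, z i • y i) := by
    simp only [smul_sub, Finset.sum_sub_distrib, map_sum, map_smul, sub_add_cancel]
    conv_lhs => rw [← Finsupp.univ_sum_single z]
    simp
  rw [hsplit, map_add, map_sum, hker, add_zero]
  · refine Finset.sum_eq_zero fun i _ => ?_
    rw [multidegreeSum_smul w fun a ha haL => ih a ha haL _ ?_,
      constantCoeff_eq_zero_of_syzygy w hinj hw hz, zero_mul]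
    rw [map_sub, hΨ, hy, monomialMap_single, one_mul, sub_self]
  · rw [map_sum, ← hz, monomialMap_apply]
    simp only [map_smul, hy, smul_eq_mul]

theorem multidegreeSum_eq_zero_of_linearlyRelated {w : Fin s → Fin n →₀ ℕ}
    (hinj : Function.Injective w) (hw : ∀ i, (w i).degree = d) {I : Ideal (SRing K n)}
    (hI : LinearMap.range (monomialMap K w) = I) (hlin : LinearlyRelated I d) {L : Fin n →₀ ℕ}
    {C : Set (Fin s)} (hC : ClosedBelow d w L C) {z : Fin s →₀ SRing K n}
    (hz : monomialMap K w z = 0) : multidegreeSum K w L C z = 0 := by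
  induction hm : L.degree using Nat.strong_induction_on generalizing L z with
  | _ m ih =>
    by_cases hL : L.degree ≤ d + 1
    · exact multidegreeSum_eq_zero_of_degree_le w hinj hw hL hC hz
    · obtain ⟨R, hR⟩ := gradedBetti_eq_zero_iff.1 (hlin 1 le_rfl (L.degree - 1) (by omega))
      have h2 : ((2 : ℕ∞)) ≤ ((1 : ℕ) : ℕ∞) + 1 := by norm_num
      refine multidegreeSum_eq_zero_of_resolution hinj hw hI (R.weaken h2) (fun k hk => hR k ?_)
        (fun a ha haL z hz => ?_) hz
      · change R.dg 1 k = _ at hk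
        omega
      · exact ih _ (hm ▸ degree_tsub_lt ha haL) (hC.mono tsub_le_self) hz rfl

/-- If all pairs of generators are connected by paths, the linear syzygies span all syzygies. -/
theorem span_linear_syzygies {w : Fin s → Fin n →₀ ℕ} (hw : ∀ i, (w i).degree = d)
    (hconn : ∀ i j, Relation.ReflTransGen
      (fun k l => w k ≤ w i ⊔ w j ∧ w l ≤ w i ⊔ w j ∧ (w k ⊔ w l).degree = d + 1) i j) :
    Submodule.span (SRing K n)
        {f | monomialMap K w f = 0 ∧ f ∈ gradedPart K n (fun _ : Fin s => d) (d + 1)}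
      = LinearMap.ker (monomialMap K w) := by
  refine le_antisymm (Submodule.span_le.2 fun f hf => hf.1) ?_
  set N := Submodule.span (SRing K n)
    {f | monomialMap K w f = 0 ∧ f ∈ gradedPart K n (fun _ : Fin s => d) (d + 1)} with hN
  have hedge : ∀ L k l, w k ≤ L → w l ≤ L → (w k ⊔ w l).degree = d + 1 →
      (Finsupp.single k (monomial (L - w k) 1) - Finsupp.single l (monomial (L - w l) 1) :
        Fin s →₀ SRing K n) ∈ N := by
    intro L k l hk hl hkl
    have hcompl : ∀ i, w i ≤ w k ⊔ w l → (w k ⊔ w l - w i).degree = 1 := by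
      intro i hi
      have h1 : (w k ⊔ w l - w i).degree + (w i).degree = d + 1 := by
        rw [← map_add, tsub_add_cancel_of_le hi, hkl]
      rw [hw] at h1
      omega
    have hlcm : (Finsupp.single k (monomial (w k ⊔ w l - w k) 1)
        - Finsupp.single l (monomial (w k ⊔ w l - w l) 1) : Fin s →₀ SRing K n) ∈ N := by
      refine Submodule.subset_span ⟨?_, ?_⟩
      · simp only [map_sub, monomialMap_single, monomial_mul, mul_one]
        rw [tsub_add_cancel_of_le le_sup_left, tsub_add_cancel_of_le le_sup_right, sub_self]
      · rw [add_comm d 1]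
        exact Submodule.sub_mem _
          (single_mem_gradedPart k (isHomogeneous_monomial _ (hcompl k le_sup_left)))
          (single_mem_gradedPart l (isHomogeneous_monomial _ (hcompl l le_sup_right)))
    have := N.smul_mem (monomial (L - w k ⊔ w l) 1 : SRing K n) hlcm
    rw [smul_sub, Finsupp.smul_single, Finsupp.smul_single, smul_eq_mul, smul_eq_mul,
      monomial_mul, monomial_mul, mul_one, tsub_add_tsub_cancel (sup_le hk hl) le_sup_left,
      tsub_add_tsub_cancel (sup_le hk hl) le_sup_right] at this
    exact this
  have hpair : ∀ L i j, w i ≤ L → w j ≤ L →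
      (Finsupp.single i (monomial (L - w i) 1) - Finsupp.single j (monomial (L - w j) 1) :
        Fin s →₀ SRing K n) ∈ N := by
    intro L i j hi hj
    have hij := sup_le hi hj
    refine (hconn i j).rec (motive := fun k _ =>
      (Finsupp.single i (monomial (L - w i) 1) - Finsupp.single k (monomial (L - w k) 1) :
        Fin s →₀ SRing K n) ∈ N) ?_ ?_
    · rw [sub_self]
      exact N.zero_mem
    · intro k l _ hkl hk
      have := N.add_mem hk (hedge L k l (hkl.1.trans hij) (hkl.2.1.trans hij) hkl.2.2)
      rwa [sub_add_sub_cancel] at this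
  have hsec : ∀ f, f - monomialSection K w (monomialMap K w f) ∈ N := by
    intro f
    induction f using free_induction with
    | h0 => simp
    | hadd f g hf hg =>
      have := N.add_mem hf hg
      rw [map_add, map_add]
      rwa [add_sub_add_comm]
    | hmon i a c =>
      have h1 : monomialMap K w (Finsupp.single i (monomial a c))
          = c • (monomial (a + w i) 1 : SRing K n) := by
        rw [monomialMap_single, monomial_mul, smul_monomial, smul_eq_mul]
      obtain ⟨j, hj, hsec⟩ := exists_monomialSection_eq (K := K) w (e := a + w i)
        ⟨i, le_add_self⟩
      have h2 := N.smul_mem (C c) (hpair (a + w i) i j le_add_self hj)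
      rw [add_tsub_cancel_right, smul_sub] at h2
      rw [h1, map_smul, hsec]
      convert h2 using 2
      · rw [Finsupp.smul_single, smul_eq_mul, C_mul_monomial, mul_one]
      · rw [Finsupp.smul_single, Finsupp.smul_single, smul_eq_mul, C_mul']
  intro f hf
  have := hsec f
  rwa [LinearMap.mem_ker.1 hf, map_zero, sub_zero] at this

/-- A presentation of `I` by linear first syzygies extends to a resolution in the next position. -/
theorem exists_linear_resolution {w : Fin s → Fin n →₀ ℕ} (hw : ∀ i, (w i).degree = d)
    {I : Ideal (SRing K n)} (hI : LinearMap.range (monomialMap K w) = I)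
    (hspan : Submodule.span (SRing K n)
        {f | monomialMap K w f = 0 ∧ f ∈ gradedPart K n (fun _ : Fin s => d) (d + 1)}
      = LinearMap.ker (monomialMap K w)) :
    ∃ R : GradedPartialRes I 2, (∀ k, R.dg 0 k = d) ∧ ∀ k, R.dg 1 k = d + 1 := by
  obtain ⟨s₁, dg₁, D₁, hrange₁, hD₁, hdg₁⟩ :=
    exists_graded_cover (fun _ : Fin s => d) (fun m => m = d + 1)
      {f | monomialMap K w f = 0 ∧ f ∈ gradedPart K n (fun _ : Fin s => d) (d + 1)}
      fun f hf => ⟨d + 1, rfl, hf.2⟩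
  obtain ⟨s₂, dg₂, D₂, hrange₂, hD₂, -⟩ :=
    exists_graded_cover dg₁ (fun _ => True) {f | D₁ f = 0 ∧ ∃ m, f ∈ gradedPart K n dg₁ m}
      fun f hf => ⟨hf.2.choose, trivial, hf.2.choose_spec⟩
  rw [hspan] at hrange₁
  rw [span_homogeneous_ker D₁ hD₁] at hrange₂
  let sz : ℕ → ℕ
    | 0 => s
    | 1 => s₁
    | 2 => s₂
    | _ => 0
  refine ⟨{
    s := sz
    dg := fun
      | 0 => fun _ : Fin s => d
      | 1 => dg₁
      | 2 => dg₂
      | _ + 3 => fun _ => 0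
    aug := monomialMap K w
    diff := fun
      | 0 => D₁
      | 1 => D₂
      | _ + 2 => 0
    aug_hom := ?_
    diff_hom := ?_
    aug_range := hI
    exact_zero := fun _ => hrange₁
    exact_succ := ?_ }, fun _ => rfl, hdg₁⟩
  · intro k
    change (monomialMap K w (Finsupp.single k 1)).IsHomogeneous d
    rw [monomialMap_single, one_mul]
    exact isHomogeneous_monomial _ (hw k)
  · rintro (_ | _ | i) k l
    · exact mem_gradedPart_iff_isHomogeneous.1 (hD₁ k) l
    · exact mem_gradedPart_iff_isHomogeneous.1 (hD₂ k) l
    · exact k.elim0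
  · rintro (_ | i) hi
    · exact hrange₂
    · exfalso
      have : ((i + 1 + 1 : ℕ) : ℕ∞) < (2 : ℕ) := by exact_mod_cast hi
      rw [Nat.cast_lt] at this
      omega

end LinearSyzygies

/-- **Corollary.** A monomial ideal `I` generated in degree `d` is linearly related iff
for all `u, v ∈ G(I)` there is a path in `G_I^{(u,v)}` connecting `u` and `v`. -/
theorem stmt1 (K : Type) [Field K] (n d : ℕ) (I : Ideal (SRing K n))
    (hgen : I = Ideal.span ((fun e => (monomial e (1:K))) '' minGen I))
    (hdeg : ∀ e ∈ minGen I, mdeg e = d) :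
    LinearlyRelated I d ↔
      ∀ u ∈ minGen I, ∀ v ∈ minGen I,
        Relation.ReflTransGen (lcmGraphAdj I d u v) u v := by
  obtain ⟨s, w, hinj, hrange⟩ := (finite_minGen hdeg).fin_param
  have hmem : ∀ i, w i ∈ minGen I := fun i => hrange ▸ Set.mem_range_self i
  have hw : ∀ i, (w i).degree = d := fun i => hdeg _ (hmem i)
  have hI : LinearMap.range (monomialMap K w) = I := by
    rw [range_monomialMap, hrange, ← hgen]
  constructor
  · intro hlin u hu v hv
    rw [← hrange] at hu hv
    obtain ⟨i, rfl⟩ := hu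
    obtain ⟨j, rfl⟩ := hv
    set L := w i ⊔ w j with hL
    let C : Set (Fin s) := {k | Relation.ReflTransGen (lcmGraphAdj I d (w i) (w j)) (w i) (w k)}
    have hC : ClosedBelow d w L C := fun k hk l hkL hlL hkl =>
      Relation.ReflTransGen.tail hk ⟨hmem k, hmem l, hkL, hlL, hkl⟩
    have hz : monomialMap K w (Finsupp.single i (monomial (L - w i) 1)
        - Finsupp.single j (monomial (L - w j) 1)) = 0 := by
      simp only [map_sub, monomialMap_single, monomial_mul, mul_one]
      rw [tsub_add_cancel_of_le le_sup_left, tsub_add_cancel_of_le le_sup_right, sub_self]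
    have h := multidegreeSum_eq_zero_of_linearlyRelated hinj hw hI hlin hC hz
    have hsingle : ∀ k, w k ≤ L → multidegreeSum K w L C
        (Finsupp.single k (monomial (L - w k) 1)) = Set.indicator C 1 k := by
      classical
      intro k hk
      rw [multidegreeSum_apply, Finset.sum_eq_single k]
      · simp [hk, Set.indicator_apply]
      · intro l _ hlk
        rw [Finsupp.single_eq_of_ne hlk]
        simp
      · simp
    rw [map_sub, hsingle i le_sup_left, hsingle j le_sup_right,
      Set.indicator_of_mem (show i ∈ C from Relation.ReflTransGen.refl)] at h
    by_contra hj
    rw [Set.indicator_of_notMem (show j ∉ C from hj)] at h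
    simp at h
  · intro hconn
    have hconn' : ∀ i j, Relation.ReflTransGen
        (fun k l => w k ≤ w i ⊔ w j ∧ w l ≤ w i ⊔ w j ∧ (w k ⊔ w l).degree = d + 1) i j := by
      intro i j
      obtain ⟨k, hk, hik⟩ := (hconn _ (hmem i) _ (hmem j)).rec (motive := fun v _ =>
        ∃ k, w k = v ∧ Relation.ReflTransGen
          (fun k l => w k ≤ w i ⊔ w j ∧ w l ≤ w i ⊔ w j ∧ (w k ⊔ w l).degree = d + 1) i k)
        ⟨i, rfl, .refl⟩ (by
          rintro _ v - hadj ⟨k, rfl, hk⟩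
          obtain ⟨l, rfl⟩ : v ∈ Set.range w := hrange ▸ hadj.2.1
          exact ⟨l, rfl, hk.tail hadj.2.2⟩)
      rwa [hinj hk] at hik
    obtain ⟨R, hR₀, hR₁⟩ := exists_linear_resolution hw hI (span_linear_syzygies hw hconn')
    intro i hi j hj
    rw [gradedBetti_eq_zero_iff]
    interval_cases i
    · refine ⟨R.weaken (by norm_num), fun k hk => ?_⟩
      have := hR₀ k
      change R.dg 0 k = _ at hk
      omega
    · refine ⟨R.weaken (by norm_num), fun k hk => ?_⟩
      have := hR₁ k
      change R.dg 1 k = _ at hk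
      omega

end
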